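/- (Soundness of IN0/1) Let G be a digraph and v ∈ V(G) a vertex with (v,v) ∉ E(G) and at most one incoming arc, i.e., |N_pre(v)| ≤ 1. Then DFVS(G) = DFVS(G∘v), and every DFVS of G∘v is a DFVS of G. -/

import Mathlib

namespace DFVSP

open scoped Classical

noncomputable section

variable {V : Type*} [Fintype V] [DecidableEq V]

/-- A digraph on the (finite) vertex set `V` is given by its finite set of arcs. -/
abbrev Dgraph (V : Type*) := Finset (V × V)

/-- `p` is a path in `G`: a list of vertices where consecutive vertices are joined by arcs. -/
def IsPath (G : Dgraph V) (p : List V) : Prop :=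
  List.Chain' (fun a b => (a, b) ∈ G) p

/-- `p` is a path in `G` that starts at `a` and ends at `b`. -/
def IsPathFrom (G : Dgraph V) (a b : V) (p : List V) : Prop :=
  IsPath G p ∧ p.head? = some a ∧ p.getLast? = some b

/-- `p` is a cycle in `G`: a path `v₁,…,vₙ` with `n ≥ 2` and `v₁ = vₙ`. -/
def IsCycle (G : Dgraph V) (p : List V) : Prop :=
  IsPath G p ∧ 2 ≤ p.length ∧ p.head? = p.getLast?

/-- `D` is a directed feedback vertex set of `G`: every cycle contains a vertex of `D`. -/
def IsDFVS (G : Dgraph V) (D : Finset V) : Prop :=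
  ∀ p : List V, IsCycle G p → ∃ x ∈ p, x ∈ D

/-- The minimum cardinality of a DFVS of `G`. -/
def dfvsNum (G : Dgraph V) : ℕ :=
  sInf {n | ∃ D : Finset V, IsDFVS G D ∧ D.card = n}

/-- `D` is a DFVS of `G` of minimum cardinality. -/
def IsMinDFVS (G : Dgraph V) (D : Finset V) : Prop :=
  IsDFVS G D ∧ ∀ D' : Finset V, IsDFVS G D' → D.card ≤ D'.card

/-- The predecessors of `v` in `G`. -/
def Npre (G : Dgraph V) (v : V) : Finset V := Finset.univ.filter fun p => (p, v) ∈ G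

/-- The successors of `v` in `G`. -/
def Nsucc (G : Dgraph V) (v : V) : Finset V := Finset.univ.filter fun s => (v, s) ∈ G

/-- The bi-edge neighbours of `v` in `G`. -/
def Nbi (G : Dgraph V) (v : V) : Finset V := Npre G v ∩ Nsucc G v

/-- The neighbours of `v` in `G`. -/
def Nbhd (G : Dgraph V) (v : V) : Finset V := Npre G v ∪ Nsucc G v

/-- The consecutive pairs of vertices along a list. -/
def consecutivePairs (p : List V) : List (V × V) := p.zip p.tail

/-- The path `p` uses a bi-edge of `G`. -/
def UsesBiEdge (G : Dgraph V) (p : List V) : Prop :=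
  ∃ q ∈ consecutivePairs p, (q.1, q.2) ∈ G ∧ (q.2, q.1) ∈ G

/-- A path (or cycle) `p` is uncovered in `G` if there is no cycle whose vertex set is a
proper subset of the vertex set of `p`. -/
def Uncovered (G : Dgraph V) (p : List V) : Prop :=
  ¬ ∃ q : List V, IsCycle G q ∧ q.toFinset ⊂ p.toFinset

/-- `G − v`: delete the vertex `v` together with all incident arcs. -/
def deleteVertex (G : Dgraph V) (v : V) : Dgraph V :=
  G.filter fun a => a.1 ≠ v ∧ a.2 ≠ v

/-- `G[A]`: the subdigraph induced by the vertex set `A`. -/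
def induce (G : Dgraph V) (A : Finset V) : Dgraph V :=
  G.filter fun a => a.1 ∈ A ∧ a.2 ∈ A

/-- The exclusion `G ∘ v`: delete `v` and add an arc `(p, s)` for every predecessor `p`
and successor `s` of `v`. -/
def exclude (G : Dgraph V) (v : V) : Dgraph V :=
  deleteVertex G v ∪ Npre G v ×ˢ Nsucc G v

/-- A diclique: all pairs of distinct vertices of `S` are joined by bi-edges. -/
def IsDiclique (G : Dgraph V) (S : Finset V) : Prop :=
  ∀ u ∈ S, ∀ w ∈ S, u ≠ w → (u, w) ∈ G ∧ (w, u) ∈ G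

/-- The arcs of `G` with no endpoint in `D`. -/
def Avoids (G : Dgraph V) (D : Finset V) (a b : V) : Prop :=
  (a, b) ∈ G ∧ a ∉ D ∧ b ∉ D

theorem isDFVS_iff (G : Dgraph V) (D : Finset V) :
    IsDFVS G D ↔ ∀ x, ¬ Relation.TransGen (Avoids G D) x x := by
  constructor
  · intro h x hx
    obtain ⟨b, hxb, hbx⟩ := Relation.TransGen.head'_iff.1 hx
    obtain ⟨l, hl, hlast⟩ := List.exists_isChain_cons_of_relationReflTransGen hbx
    have hmem : ∀ y ∈ b :: l, y ∉ D := fun y hy =>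
      List.IsChain.backwards_induction (fun y => y ∉ D) (b :: l) hl
        (fun _ _ h _ => h.2.1)
        (fun _ => by
          rw [hlast]
          exact hxb.2.1) y hy
    obtain ⟨y, hy, hyD⟩ := h (x :: b :: l)
      ⟨List.IsChain.imp (fun _ _ h => h.1) (List.IsChain.cons_cons hxb hl), by simp, by
        rw [List.getLast?_cons_cons, List.getLast?_eq_getLast_of_ne_nil (List.cons_ne_nil b l),
          hlast, List.head?_cons]⟩
    rcases List.mem_cons.1 hy with rfl | hy
    · exact hxb.2.1 hyD
    · exact hmem y hy hyD
  · rintro h p ⟨hp, hlen, hends⟩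
    by_contra! hD
    match p, hp, hlen, hends, hD with
    | a :: b :: l, hp, _, hends, hD =>
      have hchain : List.IsChain (Avoids G D) (a :: b :: l) :=
        List.IsChain.imp_of_mem_imp (fun x y hx hy hxy => ⟨hxy, hD x hx, hD y hy⟩) hp
      have hlast : List.getLast (b :: l) (List.cons_ne_nil b l) = a := by
        rw [List.getLast?_cons_cons, List.getLast?_eq_getLast_of_ne_nil (List.cons_ne_nil b l),
          List.head?_cons] at hends
        exact (Option.some.inj hends).symm
      rw [List.isChain_cons_cons] at hchain
      exact h a (Relation.TransGen.head' hchain.1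
        (List.relationReflTransGen_of_exists_isChain_cons l hchain.2 hlast))

theorem isDFVS_univ (G : Dgraph V) : IsDFVS G Finset.univ := by
  rw [isDFVS_iff]
  intro x hx
  obtain ⟨b, hxb, -⟩ := Relation.TransGen.head'_iff.1 hx
  exact hxb.2.1 (Finset.mem_univ x)

theorem dfvsNum_le_of_forall {G H : Dgraph V}
    (h : ∀ D, IsDFVS G D → ∃ D', IsDFVS H D' ∧ D'.card ≤ D.card) :
    dfvsNum H ≤ dfvsNum G := by
  obtain ⟨D, hD, hcard⟩ : dfvsNum G ∈ {n | ∃ D : Finset V, IsDFVS G D ∧ D.card = n} :=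
    Nat.sInf_mem ⟨_, Finset.univ, isDFVS_univ G, rfl⟩
  obtain ⟨D', hD', hle⟩ := h D hD
  exact le_trans (Nat.sInf_le (m := D'.card) ⟨D', hD', rfl⟩) (hle.trans hcard.le)

theorem mem_exclude {G : Dgraph V} {v a b : V} :
    (a, b) ∈ exclude G v ↔
      ((a, b) ∈ G ∧ a ≠ v ∧ b ≠ v) ∨ ((a, v) ∈ G ∧ (v, b) ∈ G) := by
  simp [exclude, deleteVertex, Npre, Nsucc]

/-- A walk in `G` from `x ≠ v` either survives in `G ∘ v` or, if it ends in `v`, does so up to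
its last arc. -/
theorem transGen_exclude {G : Dgraph V} {v : V} (hloop : (v, v) ∉ G) {D : Finset V} {x y : V}
    (hx : x ≠ v) (h : Relation.TransGen (Avoids G D) x y) :
    (y ≠ v → Relation.TransGen (Avoids (exclude G v) D) x y) ∧
      (y = v → ∃ p, Relation.ReflTransGen (Avoids (exclude G v) D) x p ∧ Avoids G D p v) := by
  induction h with
  | single hxy =>
    refine ⟨fun hy => .single ⟨mem_exclude.2 (.inl ⟨hxy.1, hx, hy⟩), hxy.2⟩, ?_⟩
    rintro rfl
    exact ⟨x, .refl, hxy⟩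
  | @tail b c _ hbc ih =>
    by_cases hb : b = v
    · subst hb
      obtain ⟨p, hxp, hpb⟩ := ih.2 rfl
      refine ⟨fun _ => .tail' hxp ⟨mem_exclude.2 (.inr ⟨hpb.1, hbc.1⟩), hpb.2.1, hbc.2.2⟩, ?_⟩
      rintro rfl
      exact absurd hbc.1 hloop
    · refine ⟨fun hc => (ih.1 hb).tail ⟨mem_exclude.2 (.inl ⟨hbc.1, hb, hc⟩), hbc.2⟩, ?_⟩
      rintro rfl
      exact ⟨b, (ih.1 hb).to_reflTransGen, hbc⟩

theorem IsDFVS.of_exclude {G : Dgraph V} {v : V} (hloop : (v, v) ∉ G) {D : Finset V}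
    (hD : IsDFVS (exclude G v) D) : IsDFVS G D := by
  rw [isDFVS_iff] at hD ⊢
  have key : ∀ x, x ≠ v → ¬ Relation.TransGen (Avoids G D) x x := fun x hx h =>
    hD x ((transGen_exclude hloop hx h).1 hx)
  intro x h
  by_cases hx : x = v
  · subst hx
    obtain ⟨c, hxc, hcx⟩ := Relation.TransGen.head'_iff.1 h
    refine key c ?_ (.tail' hcx hxc)
    rintro rfl
    exact hloop hxc.1
  · exact key x hx h

theorem IsDFVS.exclude_of_notMem {G : Dgraph V} {v : V} {D : Finset V} (hD : IsDFVS G D)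
    (hv : v ∉ D) : IsDFVS (exclude G v) D := by
  rw [isDFVS_iff] at hD ⊢
  intro x h
  refine hD x (Relation.TransGen.closed (fun a b hab => ?_) x x h)
  obtain ⟨hab, ha, hb⟩ := hab
  rcases mem_exclude.1 hab with h | h
  · exact .single ⟨h.1, ha, hb⟩
  · exact .tail (.single ⟨h.1, ha, hv⟩) ⟨h.2, hv, hb⟩

theorem IsDFVS.exclude_erase_union {G : Dgraph V} {D : Finset V} (hD : IsDFVS G D) (v : V) :
    IsDFVS (exclude G v) (D.erase v ∪ Npre G v) := by
  rw [isDFVS_iff] at hD ⊢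
  intro x h
  refine hD x (Relation.TransGen.mono (fun a b hab => ?_) x x h)
  obtain ⟨hab, ha, hb⟩ := hab
  rcases mem_exclude.1 hab with h | h
  · exact ⟨h.1, fun hm => ha (by simp [hm, h.2.1]), fun hm => hb (by simp [hm, h.2.2])⟩
  · exact absurd (by simp [Npre, h.1]) ha

/-- soundness of IN0/1. -/
theorem in01_sound (G : Dgraph V) (v : V) (hloop : (v, v) ∉ G)
    (hin : (Npre G v).card ≤ 1) :
    dfvsNum G = dfvsNum (exclude G v) ∧
      ∀ D : Finset V, IsDFVS (exclude G v) D → IsDFVS G D := by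
  refine ⟨le_antisymm ?_ ?_, fun D hD => hD.of_exclude hloop⟩
  · exact dfvsNum_le_of_forall fun D hD => ⟨D, hD.of_exclude hloop, le_rfl⟩
  · refine dfvsNum_le_of_forall fun D hD => ?_
    by_cases hv : v ∈ D
    · refine ⟨_, hD.exclude_erase_union v, (Finset.card_union_le _ _).trans ?_⟩
      have := Finset.card_erase_add_one hv
      omega
    · exact ⟨D, hD.exclude_of_notMem hv, le_rfl⟩

end

end DFVSP
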